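/- There exists a constant C > 0 such that for all R ≥ 1, |A(R) − g₁(√R)·R^{-1/4} − g₂(√R)·R^{-3/4}| ≤ C·R^{-5/4}, where g₁(x) = −(√2/π^{3/2}) Σ_{n ∈ ℤ², n ≠ 0} ‖n‖^{-5/2} cos(‖n‖x − π/4) and g₂(x) = (15√2/(8π^{3/2})) Σ_{n ∈ ℤ², n ≠ 0} ‖n‖^{-7/2} sin(‖n‖x − π/4). -/

import Mathlib

open Real MeasureTheory

/-- The Euclidean norm of a lattice point `n ∈ ℤ²`. -/
noncomputable def znorm (n : ℤ × ℤ) : ℝ :=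
  Real.sqrt ((n.1 : ℝ) ^ 2 + (n.2 : ℝ) ^ 2)

/-- `N(t)`: number of lattice points in the closed disk of radius `√t/(2π)`. -/
noncomputable def Nlat (t : ℝ) : ℕ :=
  Set.ncard {n : ℤ × ℤ | znorm n ≤ Real.sqrt t / (2 * π)}

/-- `D(t) = N(t) − t/(4π)`. -/
noncomputable def Dlat (t : ℝ) : ℝ := (Nlat t : ℝ) - t / (4 * π)

/-- `A(R) = (1/R) ∫₀^R D(t) dt`. -/
noncomputable def Alat (R : ℝ) : ℝ := (1 / R) * ∫ t in (0:ℝ)..R, Dlat t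

/-- `g₁(x) = −(√2/π^{3/2}) Σ_{n ≠ 0} ‖n‖^{-5/2} cos(‖n‖x − π/4)`. -/
noncomputable def g1 (x : ℝ) : ℝ :=
  -(Real.sqrt 2 / π ^ ((3:ℝ)/2)) *
    ∑' n : {n : ℤ × ℤ // n ≠ 0}, znorm n.1 ^ (-(5/2) : ℝ) * Real.cos (znorm n.1 * x - π/4)

/-- `g₂(x) = (15√2/(8π^{3/2})) Σ_{n ≠ 0} ‖n‖^{-7/2} sin(‖n‖x − π/4)`. -/
noncomputable def g2 (x : ℝ) : ℝ :=
  (15 * Real.sqrt 2 / (8 * π ^ ((3:ℝ)/2))) *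
    ∑' n : {n : ℤ × ℤ // n ≠ 0}, znorm n.1 ^ (-(7/2) : ℝ) * Real.sin (znorm n.1 * x - π/4)


/-- half Bessel-type integral -/
noncomputable def Ih (z : ℝ) : ℝ := ∫ u in (0:ℝ)..1, (1 - u^2) ^ ((3:ℝ)/2) * Real.cos (z * u)

noncomputable def hfun (u : ℂ) : ℂ := (1 - u^2) ^ ((3:ℂ)/2)

lemma cpow_ofReal_mul' {y : ℝ} (hy : 0 < y) {w : ℂ} (hw : w ≠ 0) (s : ℂ) :
    ((y:ℂ) * w) ^ s = (y:ℂ) ^ s * w ^ s := by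
  have hy' : (y:ℂ) ≠ 0 := by exact_mod_cast hy.ne'
  rw [Complex.cpow_def_of_ne_zero (mul_ne_zero hy' hw), Complex.cpow_def_of_ne_zero hy',
    Complex.cpow_def_of_ne_zero hw, Complex.log_ofReal_mul hy hw, ← Complex.exp_add,
    Complex.ofReal_log hy.le]
  ring_nf

lemma hfun_cont {u : ℂ} (h0 : 0 ≤ u.re) (h1 : u.re ≤ 1) :
    ContinuousAt hfun u := by
  unfold hfun
  have : ContinuousAt (fun w : ℂ => w ^ ((3:ℂ)/2)) (1 - u^2) := by
    apply Complex.continuousAt_cpow_const_of_re_pos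
    · by_cases h : u.im = 0 ∨ u.re = 0
      · left
        simp only [pow_two, Complex.sub_re, Complex.one_re, Complex.mul_re]
        rcases h with h | h <;> rw [h] <;> nlinarith
      · right
        push Not at h
        simp only [pow_two, Complex.sub_im, Complex.one_im, Complex.mul_im]
        intro h'
        apply mul_ne_zero h.1 h.2
        linarith
    · norm_num
  exact ContinuousAt.comp (f := fun u : ℂ => 1 - u^2) this (by fun_prop)

lemma hfun_diff {u : ℂ} (h0 : 0 < u.re) (h2 : 0 < u.im) :
    DifferentiableAt ℂ hfun u := by
  unfold hfun
  apply DifferentiableAt.cpow_const (by fun_prop)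
  right
  simp only [pow_two, Complex.sub_im, Complex.one_im, Complex.mul_im]
  nlinarith [mul_pos h0 h2]

noncomputable def phi (y : ℝ) : ℂ := ((y:ℂ) - 2 * Complex.I) ^ ((3:ℂ)/2)

lemma slit_aux (y : ℝ) : ((y:ℂ) - 2 * Complex.I) ∈ Complex.slitPlane := by
  right; simp

lemma base_deriv (s : ℂ) (y : ℝ) :
    HasDerivAt (fun y : ℝ => ((y:ℂ) - 2 * Complex.I) ^ s) (s * ((y:ℂ) - 2 * Complex.I) ^ (s - 1)) y := by
  have h1 : HasDerivAt (fun w : ℂ => (w - 2 * Complex.I) ^ s)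
      (s * ((y:ℂ) - 2 * Complex.I) ^ (s - 1) * 1) (y:ℂ) :=
    HasDerivAt.cpow_const (f := fun w : ℂ => w - 2 * Complex.I)
      ((hasDerivAt_id (y:ℂ)).sub_const _) (slit_aux y)
  simpa using h1.comp_ofReal

lemma phi_taylor {Y : ℝ} (hY : 0 ≤ Y) :
    ‖phi Y - phi 0 - (3/2 * (- 2 * Complex.I) ^ ((1:ℂ)/2)) * Y‖ ≤ Y^2 := by
  have h1 : ∀ y : ℝ, 0 ≤ y → ‖(3/2 : ℂ) * ((y:ℂ) - 2 * Complex.I) ^ ((1:ℂ)/2) -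
      3/2 * (- 2 * Complex.I) ^ ((1:ℂ)/2)‖ ≤ y := by
    intro y hy
    have := norm_image_sub_le_of_norm_deriv_le_segment' (a := 0) (b := y) (C := 1)
      (f := fun y : ℝ => (3/2 : ℂ) * ((y:ℂ) - 2 * Complex.I) ^ ((1:ℂ)/2))
      (fun x _ => ((base_deriv ((1:ℂ)/2) x).const_mul (3/2 : ℂ)).hasDerivWithinAt) ?_ y ⟨hy, le_rfl⟩
    · simpa using this
    · intro x hx
      have h2 : (2:ℝ) ≤ ‖(x:ℂ) - 2 * Complex.I‖ := by
        have := Complex.abs_im_le_norm ((x:ℂ) - 2 * Complex.I)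
        simpa using this
      have hne : (x:ℂ) - 2 * Complex.I ≠ 0 := by
        intro h; rw [h] at h2; norm_num at h2
      have e : ((1:ℂ)/2 - 1) = ((-(1/2) : ℝ) : ℂ) := by push_cast; norm_num
      rw [e, norm_mul, norm_mul, Complex.norm_cpow_real]
      have : ‖(x:ℂ) - 2 * Complex.I‖ ^ (-(1/2):ℝ) ≤ 1 :=
        Real.rpow_le_one_of_one_le_of_nonpos (by linarith) (by norm_num)
      norm_num
      norm_num at this
      linarith
  have := norm_image_sub_le_of_norm_deriv_le_segment' (a := 0) (b := Y) (C := Y)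
      (f := fun y : ℝ => phi y - (3/2 * (- 2 * Complex.I) ^ ((1:ℂ)/2)) * y)
      (f' := fun y : ℝ => (3/2 : ℂ) * ((y:ℂ) - 2 * Complex.I) ^ ((1:ℂ)/2) -
      3/2 * (- 2 * Complex.I) ^ ((1:ℂ)/2))
      (fun x _ => by
        have h := (base_deriv ((3:ℂ)/2) x)
        have e : ((3:ℂ)/2 - 1) = 1/2 := by norm_num
        rw [e] at h
        have h3 : HasDerivAt (fun y : ℝ => (3/2 * (- 2 * Complex.I) ^ ((1:ℂ)/2)) * (y:ℂ)) 
            (3/2 * (- 2 * Complex.I) ^ ((1:ℂ)/2)) x := by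
          simpa using (Complex.ofRealCLM.hasDerivAt (x := x)).const_mul (3/2 * (- 2 * Complex.I) ^ ((1:ℂ)/2))
        exact (h.sub h3).hasDerivWithinAt) (fun x hx => (h1 x hx.1).trans hx.2.le) Y ⟨hY, le_rfl⟩
  simp only [Complex.ofReal_zero, mul_zero, sub_zero] at this
  calc _ = ‖phi Y - (3/2 * (- 2 * Complex.I) ^ ((1:ℂ)/2)) * Y - phi 0‖ := by congr 1; ring
    _ ≤ _ := this
    _ = _ := by ring

lemma cpow_neg2I (s : ℝ) : (-2 * Complex.I) ^ (s:ℂ) = ((2:ℝ)^s : ℝ) * Complex.exp (-(π/2*s) * Complex.I) := by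
  have : (-2 * Complex.I) = ((2:ℝ):ℂ) * (-Complex.I) := by push_cast; ring
  rw [this, cpow_ofReal_mul' (by norm_num) (by simp), Complex.ofReal_cpow (by norm_num),
    Complex.cpow_def_of_ne_zero (x := -Complex.I) (by simp), Complex.log_neg_I]
  congr 2
  push_cast
  ring

lemma hfun_one_add {y : ℝ} (hy : 0 < y) : hfun (1 + y * Complex.I) = (y ^ ((3:ℝ)/2) : ℝ) * phi y := by
  unfold hfun phi
  have e : 1 - (1 + (y:ℂ) * Complex.I)^2 = y * ((y:ℂ) - 2 * Complex.I) := by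
    ring_nf; rw [Complex.I_sq]; ring
  rw [e, cpow_ofReal_mul' hy (Complex.slitPlane_ne_zero (slit_aux y)), Complex.ofReal_cpow hy.le]
  congr 2; push_cast; rfl

lemma hfun_real {u : ℝ} (h0 : 0 ≤ u) (h1 : u ≤ 1) : hfun u = (((1-u^2) ^ ((3:ℝ)/2) : ℝ):ℂ) := by
  unfold hfun
  rw [Complex.ofReal_cpow (by nlinarith)]
  push_cast; rfl

lemma hfun_imag (y : ℝ) : hfun (y * Complex.I) = (((1+y^2) ^ ((3:ℝ)/2) : ℝ):ℂ) := by
  unfold hfun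
  rw [Complex.ofReal_cpow (by positivity)]
  push_cast; rw [mul_pow, Complex.I_sq]; ring_nf

lemma contour {z T : ℝ} (hT : 0 ≤ T) :
    |Ih z - (-Complex.I * Complex.exp (z * Complex.I) * ∫ y in (0:ℝ)..T, 
      ((y ^ ((3:ℝ)/2) * Real.exp (-(z * y)) : ℝ) : ℂ) * phi y).re| ≤ (2+T^2)^2 * Real.exp (-(z*T)) := by
  have key := Complex.integral_boundary_rect_eq_zero_of_continuousOn_of_differentiableOn
    (fun u => hfun u * Complex.exp (z * u * Complex.I)) 0 (1 + T * Complex.I) ?_ ?_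
  · simp only [Complex.zero_re, Complex.zero_im, Complex.add_re, Complex.one_re, Complex.mul_re,
      Complex.ofReal_re, Complex.I_re, mul_zero, Complex.ofReal_im, Complex.I_im, mul_one, sub_self,
      add_zero, Complex.add_im, Complex.one_im, Complex.mul_im, zero_add, Complex.ofReal_zero, zero_mul,
      Complex.ofReal_one, smul_eq_mul] at key
    have e1 : (∫ x in (0:ℝ)..1, hfun x * Complex.exp (z * x * Complex.I)).re = Ih z := by
      have := Complex.reCLM.intervalIntegral_comp_comm (a := 0) (b := 1) (μ := volume) (f := fun x : ℝ => hfun x * Complex.exp (z * x * Complex.I)) ?_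
      · simp only [Complex.reCLM_apply] at this
        rw [← this]
        unfold Ih
        apply intervalIntegral.integral_congr
        intro x hx
        rw [Set.uIcc_of_le zero_le_one] at hx
        simp only
        rw [hfun_real hx.1 hx.2, Complex.re_ofReal_mul, ← Complex.ofReal_mul, Complex.exp_ofReal_mul_I_re]
      · apply ContinuousOn.intervalIntegrable
        intro x hx
        rw [Set.uIcc_of_le zero_le_one] at hx
        apply ContinuousAt.continuousWithinAt
        apply ContinuousAt.mul _ (by fun_prop)
        exact ContinuousAt.comp (f := fun x : ℝ => (x:ℂ)) (hfun_cont (by simpa using hx.1) (by simpa using hx.2)) (by fun_prop)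
    have e2 : (Complex.I * ∫ y in (0:ℝ)..T, hfun (y * Complex.I) * Complex.exp (z * (y * Complex.I) * Complex.I)).re = 0 := by
      have : ∀ y : ℝ, hfun (y * Complex.I) * Complex.exp (z * (y * Complex.I) * Complex.I)
          = (((1+y^2) ^ ((3:ℝ)/2) * Real.exp (-(z * y)) : ℝ) : ℂ) := by
        intro y
        rw [hfun_imag]
        push_cast
        congr 2
        ring_nf; rw [Complex.I_sq]; ring
      simp_rw [this]
      rw [intervalIntegral.integral_ofReal]
      simp
    have e3 : ∫ y in (0:ℝ)..T, hfun (1 + y * Complex.I) * Complex.exp (z * (1 + y * Complex.I) * Complex.I)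
        = Complex.exp (z * Complex.I) * ∫ y in (0:ℝ)..T, 
      ((y ^ ((3:ℝ)/2) * Real.exp (-(z * y)) : ℝ) : ℂ) * phi y := by
      rw [← intervalIntegral.integral_const_mul]
      apply intervalIntegral.integral_congr_ae
      refine Filter.Eventually.of_forall fun y hy => ?_
      rw [Set.uIoc_of_le hT] at hy
      rw [hfun_one_add hy.1]
      have : Complex.exp (z * (1 + y * Complex.I) * Complex.I) = 
        Complex.exp (z * Complex.I) * (Real.exp (-(z*y)):ℝ) := by
        push_cast
        rw [← Complex.exp_add]
        congr 1
        ring_nf; rw [Complex.I_sq]; ring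
      rw [this]; push_cast; ring
    have e4 : ‖∫ x in (0:ℝ)..1, hfun (x + T * Complex.I) * Complex.exp (z * (x + T * Complex.I) * Complex.I)‖ 
        ≤ (2+T^2)^2 * Real.exp (-(z*T)) := by
      have := intervalIntegral.norm_integral_le_of_norm_le_const (a := 0) (b := 1) (C := (2+T^2)^2 * Real.exp (-(z*T)))
        (f := fun x : ℝ => hfun (x + T * Complex.I) * Complex.exp (z * (x + T * Complex.I) * Complex.I)) ?_
      · simpa using this
      · intro x hx
        rw [Set.uIoc_of_le zero_le_one] at hx
        rw [norm_mul, Complex.norm_exp]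
        have : (z * (x + T * Complex.I) * Complex.I).re = -(z*T) := by simp
        rw [this]
        gcongr
        unfold hfun
        have e : (3:ℂ)/2 = ((3/2 : ℝ) : ℂ) := by push_cast; rfl
        rw [e, Complex.norm_cpow_real]
        have hb : ‖1 - ((x:ℂ) + T * Complex.I)^2‖ ≤ 2 + T^2 := by
          calc _ ≤ ‖(1:ℂ)‖ + ‖((x:ℂ) + T * Complex.I)^2‖ := norm_sub_le _ _
            _ = 1 + (x^2 + T^2) := by 
              rw [norm_pow, ← Complex.normSq_eq_norm_sq, Complex.normSq_add_mul_I]; simp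
            _ ≤ _ := by nlinarith [hx.1, hx.2]
        calc _ ≤ (2+T^2)^(3/2:ℝ) := by gcongr
          _ ≤ (2+T^2)^(2:ℝ) := Real.rpow_le_rpow_of_exponent_le (by nlinarith) (by norm_num)
          _ = _ := by norm_cast
    rw [e3] at key
    have key2 := congrArg Complex.re key
    rw [Complex.sub_re, Complex.add_re, Complex.sub_re, e1, e2] at key2
    have := (Complex.abs_re_le_norm _).trans e4
    refine le_trans (le_of_eq ?_) this
    congr 1
    rw [mul_assoc, neg_mul, Complex.neg_re]
    simp only [Complex.zero_re] at key2
    linarith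
  · intro u hu
    simp [Complex.mem_reProdIm, Set.uIcc_of_le hT] at hu
    apply ContinuousAt.continuousWithinAt
    exact (hfun_cont hu.1.1 hu.1.2).mul (by fun_prop)
  · intro u hu
    simp [Complex.mem_reProdIm, hT] at hu
    apply DifferentiableAt.differentiableWithinAt
    exact (hfun_diff hu.1.1 hu.2.1).mul (by fun_prop)


lemma mom_integrable {z : ℝ} (hz : 0 < z) {s : ℝ} (hs : 0 < s) :
    IntegrableOn (fun y : ℝ => y ^ s * Real.exp (-(z * y))) (Set.Ioi 0) := by
  have := integrableOn_rpow_mul_exp_neg_mul_rpow (s := s) (p := 1) (b := z) (by linarith) one_pos hz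
  simpa using this

lemma mom_integral {z : ℝ} (hz : 0 < z) {s : ℝ} (hs : 0 < s) :
    ∫ y in Set.Ioi (0:ℝ), y ^ s * Real.exp (-(z * y)) = z ^ (-(s+1)) * Real.Gamma (s+1) := by
  have := Real.integral_rpow_mul_exp_neg_mul_Ioi (a := s+1) (r := z) (by linarith) hz
  rw [add_sub_cancel_right] at this
  rw [this, one_div, Real.inv_rpow hz.le, Real.rpow_neg hz.le]

lemma phi_cont : Continuous phi := by
  rw [continuous_iff_continuousAt]
  intro y
  exact (base_deriv _ y).continuousAt

lemma Gamma52 : Real.Gamma (3/2+1) = 3/4 * √π := by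
  rw [Real.Gamma_add_one (by norm_num), show (3/2:ℝ) = 1/2+1 by norm_num, Real.Gamma_add_one (by norm_num),
    Real.Gamma_one_half_eq]; ring

lemma Gamma72 : Real.Gamma (5/2+1) = 15/8 * √π := by
  rw [Real.Gamma_add_one (by norm_num), show (5/2:ℝ) = 3/2+1 by norm_num, Gamma52]; ring

lemma two_rpow_32 : (2:ℝ) ^ ((3:ℝ)/2) = 2 * √2 := by
  rw [show (3:ℝ)/2 = 1 + 1/2 by norm_num, Real.rpow_add (by norm_num), Real.rpow_one, Real.sqrt_eq_rpow]

lemma phi_zero : phi 0 = (2 * √2 : ℝ) * Complex.exp (-(3*π/4) * Complex.I) := by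
  have := cpow_neg2I (3/2)
  unfold phi
  rw [← two_rpow_32]
  push_cast at this ⊢
  rw [zero_sub, ← neg_mul, this]
  congr 2; ring

lemma phi_one : (3/2 * (- 2 * Complex.I) ^ ((1:ℂ)/2)) = (3/2 * √2 : ℝ) * Complex.exp (-(π/4) * Complex.I) := by
  have := cpow_neg2I (1/2)
  rw [Real.sqrt_eq_rpow]
  push_cast at this ⊢
  rw [this, mul_assoc]
  congr 3; ring

lemma re0 (z : ℝ) : (-Complex.I * Complex.exp (z * Complex.I) * Complex.exp (-(3*π/4) * Complex.I)).re
    = - Real.cos (z - π/4) := by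
  have : -Complex.I = Complex.exp (((-(π/2):ℝ):ℂ) * Complex.I) := by
    rw [Complex.exp_mul_I]; push_cast; simp [Complex.cos_neg, Complex.sin_neg]
  rw [this, ← Complex.exp_add, ← Complex.exp_add]
  have e : ((-(π/2):ℝ):ℂ) * Complex.I + z * Complex.I + -(3*π/4) * Complex.I = ((z - π/4 - π : ℝ):ℂ) * Complex.I := by
    push_cast; ring
  rw [e, Complex.exp_ofReal_mul_I_re, Real.cos_sub_pi]

lemma re1 (z : ℝ) : (-Complex.I * Complex.exp (z * Complex.I) * Complex.exp (-(π/4) * Complex.I)).re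
    = Real.sin (z - π/4) := by
  rw [mul_assoc, ← Complex.exp_add]
  have e : z * Complex.I + -(π/4) * Complex.I = ((z - π/4 : ℝ):ℂ) * Complex.I := by
    push_cast; ring
  rw [e]
  simp only [Complex.mul_re, Complex.neg_re, Complex.neg_im, Complex.I_re, Complex.I_im, Complex.exp_ofReal_mul_I_im]
  ring

lemma Ih_asymp {z : ℝ} (hz : 1 ≤ z) :
    |Ih z - (-(3/2 * √2 * √π) * Real.cos (z - π/4) * z ^ (-(5/2):ℝ)
      + 45/16 * √2 * √π * Real.sin (z - π/4) * z ^ (-(7/2):ℝ))| ≤ Real.Gamma (9/2) * z ^ (-(9/2):ℝ) := by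
  have hz0 : 0 < z := by linarith
  set c1 : ℂ := (3/2 * (- 2 * Complex.I) ^ ((1:ℂ)/2)) with hc1
  let E : ℝ → ℂ := fun y => phi y - phi 0 - c1 * y
  have hEc : Continuous E := by
    have := phi_cont
    fun_prop
  let m : ℝ → ℝ → ℝ := fun s y => y ^ s * Real.exp (-(z * y))
  have hm : ∀ s, 0 < s → IntegrableOn (m s) (Set.Ioi 0) := fun s hs => mom_integrable hz0 hs
  have hb : ∀ y ∈ Set.Ioi (0:ℝ), ‖((m (3/2) y : ℝ) : ℂ) * E y‖ ≤ m (7/2) y := by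
    intro y hy
    have hy' : 0 < y := hy
    rw [norm_mul, Complex.norm_real, Real.norm_of_nonneg (by positivity)]
    have := phi_taylor hy'.le
    calc _ ≤ m (3/2) y * y^2 := by gcongr
      _ = _ := by
        simp only [m]
        rw [show (7/2:ℝ) = 3/2 + (2:ℕ) by norm_num, Real.rpow_add_natCast hy'.ne']; ring
  have hEi : IntegrableOn (fun y => ((m (3/2) y : ℝ) : ℂ) * E y) (Set.Ioi 0) := by
    refine Integrable.mono' (hm (7/2) (by norm_num)) ?_ ?_
    · apply AEStronglyMeasurable.mul _ hEc.aestronglyMeasurable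
      exact Complex.continuous_ofReal.comp_aestronglyMeasurable (hm (3/2) (by norm_num)).1
    · exact (ae_restrict_iff' measurableSet_Ioi).2 (Filter.Eventually.of_forall hb)
  have hEb : ‖∫ y in Set.Ioi (0:ℝ), ((m (3/2) y : ℝ) : ℂ) * E y‖ ≤ Real.Gamma (9/2) * z ^ (-(9/2):ℝ) := by
    refine (norm_integral_le_of_norm_le (hm (7/2) (by norm_num)) 
      ((ae_restrict_iff' measurableSet_Ioi).2 (Filter.Eventually.of_forall hb))).trans ?_
    simp only [m]
    rw [mom_integral hz0 (by norm_num)]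
    norm_num [mul_comm]
  have h0i : IntegrableOn (fun y => ((m (3/2) y : ℝ) : ℂ) * phi 0) (Set.Ioi 0) :=
    ((hm (3/2) (by norm_num)).ofReal).mul_const _
  have h1i : IntegrableOn (fun y => ((m (5/2) y : ℝ) : ℂ) * c1) (Set.Ioi 0) :=
    ((hm (5/2) (by norm_num)).ofReal).mul_const _
  have hsplit : ∀ y ∈ Set.Ioi (0:ℝ), ((y ^ ((3:ℝ)/2) * Real.exp (-(z * y)) : ℝ) : ℂ) * phi y =
      (((m (3/2) y : ℝ) : ℂ) * phi 0 + ((m (5/2) y : ℝ) : ℂ) * c1) + ((m (3/2) y : ℝ) : ℂ) * E y := by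
    intro y hy
    have hy' : 0 < y := hy
    have : m (5/2) y = m (3/2) y * y := by
      simp only [m]
      rw [show (5/2:ℝ) = 3/2 + (1:ℕ) by norm_num, Real.rpow_add_natCast hy'.ne']; ring
    rw [this]
    simp only [m, E]
    push_cast
    ring
  have hInt0 : IntegrableOn (fun y : ℝ => ((y ^ ((3:ℝ)/2) * Real.exp (-(z * y)) : ℝ) : ℂ) * phi y) (Set.Ioi 0) :=
    IntegrableOn.congr_fun ((h0i.add h1i).add hEi) (fun y hy => (hsplit y hy).symm) measurableSet_Ioi
  have hlim : Ih z = (-Complex.I * Complex.exp (z * Complex.I) * ∫ y in Set.Ioi (0:ℝ), 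
      ((y ^ ((3:ℝ)/2) * Real.exp (-(z * y)) : ℝ) : ℂ) * phi y).re := by
    have t1 := intervalIntegral_tendsto_integral_Ioi (0:ℝ) hInt0 Filter.tendsto_id
    have t2 := (Complex.continuous_re.tendsto _).comp (t1.const_mul (-Complex.I * Complex.exp (z * Complex.I)))
    refine tendsto_nhds_unique ?_ t2
    have t3 : Filter.Tendsto (fun T : ℝ => (2+T^2)^2 * Real.exp (-T)) Filter.atTop (nhds 0) := by
      have a0 := Real.tendsto_pow_mul_exp_neg_atTop_nhds_zero 0
      have a2 := Real.tendsto_pow_mul_exp_neg_atTop_nhds_zero 2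
      have a4 := Real.tendsto_pow_mul_exp_neg_atTop_nhds_zero 4
      have := ((a0.const_mul 4).add (a2.const_mul 4)).add a4
      simp only [mul_zero, add_zero] at this
      refine this.congr fun T => ?_
      ring
    rw [tendsto_iff_norm_sub_tendsto_zero] 
    refine squeeze_zero' (Filter.Eventually.of_forall fun _ => norm_nonneg _) ?_ t3
    filter_upwards [Filter.eventually_ge_atTop 0] with T hT
    rw [norm_sub_rev, Real.norm_eq_abs]
    refine le_trans ?_ ((contour (z := z) hT).trans ?_)
    · exact le_rfl
    · gcongr; nlinarith
  have h01 : IntegrableOn (fun y => ((m (3/2) y : ℝ) : ℂ) * phi 0 + ((m (5/2) y : ℝ) : ℂ) * c1) (Set.Ioi 0) :=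
    h0i.add h1i
  rw [hlim, setIntegral_congr_fun measurableSet_Ioi hsplit, integral_add h01 hEi, integral_add h0i h1i,
    integral_mul_const, integral_mul_const, integral_complex_ofReal, integral_complex_ofReal]
  simp only [m] at hEb ⊢
  rw [mom_integral hz0 (by norm_num), mom_integral hz0 (by norm_num), Gamma52, Gamma72, phi_zero, hc1, phi_one, mul_add, mul_add,
    Complex.add_re, Complex.add_re]
  have r0 : (-Complex.I * Complex.exp (z * Complex.I) * (((z ^ (-(3/2 + 1):ℝ) * (3/4 * √π) : ℝ):ℂ) *
      ((2 * √2 : ℝ) * Complex.exp (-(3*π/4) * Complex.I)))).re = -(3/2 * √2 * √π) * Real.cos (z - π/4) * z ^ (-(5/2):ℝ) := by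
    have := re0 z
    rw [show -Complex.I * Complex.exp (z * Complex.I) * (((z ^ (-(3/2 + 1):ℝ) * (3/4 * √π) : ℝ):ℂ) *
      ((2 * √2 : ℝ) * Complex.exp (-(3*π/4) * Complex.I))) = ((z ^ (-(3/2 + 1):ℝ) * (3/4 * √π) * (2 * √2) : ℝ):ℂ) * 
      (-Complex.I * Complex.exp (z * Complex.I) * Complex.exp (-(3*π/4) * Complex.I)) by push_cast; ring, Complex.re_ofReal_mul, this]
    norm_num; ring
  have r1 : (-Complex.I * Complex.exp (z * Complex.I) * (((z ^ (-(5/2 + 1):ℝ) * (15/8 * √π) : ℝ):ℂ) *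
      ((3/2 * √2 : ℝ) * Complex.exp (-(π/4) * Complex.I)))).re = 45/16 * √2 * √π * Real.sin (z - π/4) * z ^ (-(7/2):ℝ) := by
    have := re1 z
    rw [show -Complex.I * Complex.exp (z * Complex.I) * (((z ^ (-(5/2 + 1):ℝ) * (15/8 * √π) : ℝ):ℂ) *
      ((3/2 * √2 : ℝ) * Complex.exp (-(π/4) * Complex.I))) = ((z ^ (-(5/2 + 1):ℝ) * (15/8 * √π) * (3/2 * √2) : ℝ):ℂ) * 
      (-Complex.I * Complex.exp (z * Complex.I) * Complex.exp (-(π/4) * Complex.I)) by push_cast; ring, Complex.re_ofReal_mul, this]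
    norm_num; ring
  rw [r0, r1, add_sub_cancel_left]
  refine (Complex.abs_re_le_norm _).trans ?_
  rw [norm_mul, norm_mul, Complex.norm_exp_ofReal_mul_I]
  simpa using hEb


noncomputable def ff (X x y : ℝ) : ℝ := max (X - x^2 - y^2) 0

lemma ff_zero {X x y : ℝ} (h : X ≤ x^2 + y^2) : ff X x y = 0 := by
  unfold ff; exact max_eq_right (by linarith)

lemma integral_eq_interval {f : ℝ → ℂ} {a b : ℝ} (h : ∀ x, x ∉ Set.Ioo a b → f x = 0) :
    ∫ x, f x = ∫ x in a..b, f x := by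
  rw [intervalIntegral.integral_eq_integral_of_support_subset]
  intro x hx
  by_contra h'
  exact hx (h x fun h2 => h' ⟨h2.1, h2.2.le⟩)

lemma inner_int (a : ℝ) : ∫ y : ℝ, ((max (a - y^2) 0 : ℝ) : ℂ) = ((4/3 * (max a 0) ^ ((3:ℝ)/2) : ℝ) : ℂ) := by
  rcases le_or_gt a 0 with ha | ha
  · have : ∀ y : ℝ, max (a - y^2) 0 = 0 := fun y => max_eq_right (by nlinarith)
    simp [this, max_eq_right ha]
  · have hs := Real.sqrt_nonneg a
    have hs2 := Real.sq_sqrt ha.le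
    rw [integral_eq_interval (a := -√a) (b := √a), intervalIntegral.integral_ofReal]
    · congr 1
      have : ∫ y in (-√a)..√a, max (a - y^2) 0 = ∫ y in (-√a)..√a, (a - y^2) := by
        apply intervalIntegral.integral_congr
        intro y hy
        rw [Set.uIcc_of_le (by linarith)] at hy
        exact max_eq_left (by nlinarith [abs_le.2 hy, sq_abs y, abs_nonneg y])
      rw [this, intervalIntegral.integral_sub (by simp) (by simp), max_eq_left ha.le]
      have e : a ^ ((3:ℝ)/2) = a * √a := by
        rw [show (3:ℝ)/2 = 1 + 1/2 by norm_num, Real.rpow_add ha, Real.rpow_one, Real.sqrt_eq_rpow]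
      rw [e]
      simp
      have : √a ^ 3 = a * √a := by rw [pow_succ, hs2]
      rw [Odd.neg_pow (by decide), this]; ring
    · intro y hy
      simp only [Set.mem_Ioo, not_and_or, not_lt] at hy
      rw [max_eq_right]; · simp
      rcases hy with h | h <;> nlinarith

noncomputable def KK (X k l : ℝ) (p : ℝ × ℝ) : ℂ :=
  Complex.exp (((-2 * π * (p.1 * k + p.2 * l) : ℝ) : ℂ) * Complex.I) * (ff X p.1 p.2 : ℝ)

lemma KK_cont (X k l : ℝ) : Continuous (KK X k l) := by
  unfold KK ff; fun_prop

lemma KK_int (X k l : ℝ) : Integrable (KK X k l) := by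
  apply (KK_cont X k l).integrable_of_hasCompactSupport
  apply HasCompactSupport.intro (K := Set.Icc (-(|X|+1)) (|X|+1) ×ˢ Set.Icc (-(|X|+1)) (|X|+1))
    (isCompact_Icc.prod isCompact_Icc)
  intro p hp
  unfold KK
  rw [ff_zero]; · simp
  rw [Set.mem_prod, Set.mem_Icc, Set.mem_Icc, ← abs_le, ← abs_le, not_and_or, not_le, not_le] at hp
  rw [← sq_abs p.1, ← sq_abs p.2]
  rcases hp with h | h <;> nlinarith [le_abs_self X, abs_nonneg X, abs_nonneg p.1, abs_nonneg p.2]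

lemma KK_rot (X k l : ℝ) : ∫ p, KK X k l p = ∫ p, KK X (√(k^2+l^2)) 0 p := by
  by_cases h0 : k^2 + l^2 = 0
  · have hk : k = 0 := by nlinarith [sq_nonneg k, sq_nonneg l]
    have hl : l = 0 := by nlinarith [sq_nonneg k, sq_nonneg l]
    simp [hk, hl]
  have hpos : 0 < k^2 + l^2 := lt_of_le_of_ne (by positivity) (Ne.symm h0)
  set r := √(k^2+l^2) with hr
  have hr0 : 0 < r := Real.sqrt_pos.2 hpos
  have hr2 : r^2 = k^2 + l^2 := Real.sq_sqrt hpos.le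
  have hm := Complex.volume_preserving_equiv_real_prod
  rw [← hm.integral_comp Complex.measurableEquivRealProd.measurableEmbedding,
    ← hm.integral_comp Complex.measurableEquivRealProd.measurableEmbedding]
  have hn : ‖((k/r : ℝ) : ℂ) + (l/r : ℝ) * Complex.I‖ = 1 := by
    rw [← sq_eq_sq₀ (norm_nonneg _) zero_le_one, ← Complex.normSq_eq_norm_sq, Complex.normSq_add_mul_I]
    field_simp; linarith
  obtain ⟨c, hc⟩ : ∃ c : Circle, (c : ℂ) = ((k/r : ℝ) : ℂ) + (l/r : ℝ) * Complex.I :=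
    ⟨⟨_, mem_sphere_zero_iff_norm.2 hn⟩, rfl⟩
  have hrot := (rotation c).measurePreserving
  rw [← hrot.integral_comp (rotation c).toHomeomorph.measurableEmbedding]
  congr 1
  ext w
  simp only [KK, Complex.measurableEquivRealProd_apply, rotation_apply, hc]
  have e1 : ((((k/r : ℝ) : ℂ) + (l/r : ℝ) * Complex.I) * w).re = k/r * w.re - l/r * w.im := by
    simp
  have e2 : ((((k/r : ℝ) : ℂ) + (l/r : ℝ) * Complex.I) * w).im = k/r * w.im + l/r * w.re := by
    simp
  rw [e1, e2]
  have e3 : (k/r * w.re - l/r * w.im) * k + (k/r * w.im + l/r * w.re) * l = w.re * r + w.im * 0 := by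
    field_simp
    linear_combination (-w.re) * hr2
  have e4 : ff X (k/r * w.re - l/r * w.im) (k/r * w.im + l/r * w.re) = ff X w.re w.im := by
    unfold ff
    congr 1
    have : (k/r * w.re - l/r * w.im)^2 + (k/r * w.im + l/r * w.re)^2 = w.re^2 + w.im^2 := by
      field_simp
      rw [hr2]; ring
    linarith
  rw [e3, e4]

lemma outer_int (t : ℝ) : ∫ u : ℝ, Complex.exp (((-(t * u) : ℝ) : ℂ) * Complex.I) * (((max (1 - u^2) 0) ^ ((3:ℝ)/2) : ℝ) : ℂ)
    = ((2 * Ih t : ℝ) : ℂ) := by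
  set g : ℝ → ℂ := fun u => Complex.exp (((-(t * u) : ℝ) : ℂ) * Complex.I) * (((max (1 - u^2) 0) ^ ((3:ℝ)/2) : ℝ) : ℂ) with hg
  have hgc : Continuous g := by
    have : Continuous fun u : ℝ => (max (1 - u^2) 0) ^ ((3:ℝ)/2) :=
      Continuous.rpow_const (by fun_prop) (fun _ => Or.inr (by norm_num))
    fun_prop
  have hgn : Continuous fun x => g (-x) := hgc.comp continuous_neg
  rw [integral_eq_interval (a := -1) (b := 1)]
  · rw [← intervalIntegral.integral_add_adjacent_intervals (b := 0) (hgc.intervalIntegrable _ _) (hgc.intervalIntegrable _ _)]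
    have : ∫ x in (-1:ℝ)..0, g x = ∫ x in (0:ℝ)..1, g (-x) := by
      rw [intervalIntegral.integral_comp_neg]; simp
    rw [this, ← intervalIntegral.integral_add (hgn.intervalIntegrable _ _) (hgc.intervalIntegrable _ _)]
    unfold Ih
    rw [← intervalIntegral.integral_const_mul, ← intervalIntegral.integral_ofReal]
    apply intervalIntegral.integral_congr
    intro u hu
    rw [Set.uIcc_of_le zero_le_one] at hu
    simp only [hg]
    rw [neg_sq, max_eq_left (by nlinarith [hu.1, hu.2])]
    push_cast
    rw [Complex.cos]
    ring_nf
  · intro u hu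
    simp only [Set.mem_Ioo, not_and_or, not_lt] at hu
    rw [max_eq_right, Real.zero_rpow (by norm_num)]; · simp
    rcases hu with h | h <;> nlinarith

lemma KK_val {X : ℝ} (hX : 0 < X) (k l : ℝ) :
    ∫ p, KK X k l p = ((8/3 * X^2 * Ih (2 * π * √X * √(k^2+l^2)) : ℝ) : ℂ) := by
  rw [KK_rot]
  set r := √(k^2+l^2)
  have hs : 0 < √X := Real.sqrt_pos.2 hX
  have hs2 := Real.sq_sqrt hX.le
  rw [Measure.volume_eq_prod, integral_prod _ (by rw [← Measure.volume_eq_prod]; exact KK_int X r 0)]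
  have h1 : ∀ x : ℝ, ∫ y, KK X r 0 (x, y) = Complex.exp (((-2 * π * (x * r) : ℝ) : ℂ) * Complex.I) * 
      ((4/3 * (max (X - x^2) 0) ^ ((3:ℝ)/2) : ℝ) : ℂ) := by
    intro x
    rw [← inner_int, ← integral_const_mul]
    congr 1
    ext y
    simp [KK, ff]
  simp_rw [h1]
  have h2 := Measure.integral_comp_mul_left (fun x : ℝ => Complex.exp (((-2 * π * (x * r) : ℝ) : ℂ) * Complex.I) * 
      ((4/3 * (max (X - x^2) 0) ^ ((3:ℝ)/2) : ℝ) : ℂ)) (√X)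
  have h3 : ∀ u : ℝ, Complex.exp (((-2 * π * (√X * u * r) : ℝ) : ℂ) * Complex.I) * 
      ((4/3 * (max (X - (√X * u)^2) 0) ^ ((3:ℝ)/2) : ℝ) : ℂ) = ((4/3 * (X * √X) : ℝ) : ℂ) * 
      (Complex.exp (((-(2 * π * √X * r * u) : ℝ) : ℂ) * Complex.I) * (((max (1 - u^2) 0) ^ ((3:ℝ)/2) : ℝ) : ℂ)) := by
    intro u
    have e : X - (√X * u)^2 = X * (1 - u^2) := by rw [mul_pow, hs2]; ring
    have e2 : max (X * (1 - u^2)) 0 = X * max (1 - u^2) 0 := by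
      rw [mul_max_of_nonneg _ _ hX.le, mul_zero]
    have e3 : X ^ ((3:ℝ)/2) = X * √X := by
      rw [show (3:ℝ)/2 = 1 + 1/2 by norm_num, Real.rpow_add hX, Real.rpow_one, Real.sqrt_eq_rpow]
    rw [e, e2, Real.mul_rpow hX.le (le_max_right _ _), e3,
      show -2 * π * (√X * u * r) = -(2 * π * √X * r * u) by ring]
    push_cast
    ring
  simp_rw [h3] at h2
  rw [integral_const_mul, outer_int, abs_of_pos (inv_pos.2 hs)] at h2
  have h4 : ∀ A B : ℂ, A = (√X)⁻¹ • B → B = (√X : ℝ) * A := by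
    intro A B h
    rw [h, Complex.real_smul]
    push_cast
    rw [mul_inv_cancel_left₀]
    exact_mod_cast hs.ne'
  rw [h4 _ _ h2]
  norm_cast
  rw [show √X * (4/3 * (X * √X) * (2 * Ih (2 * π * √X * r))) = 8/3 * (√X^2) * X * Ih (2 * π * √X * r) by ring, hs2]
  ring

lemma Ih_zero : Ih 0 = 3 * π / 16 := by
  unfold Ih
  simp only [zero_mul, Real.cos_zero, mul_one]
  have := intervalIntegral.integral_eq_sub_of_hasDerivAt_of_le (a := 0) (b := 1) 
    (f := fun u : ℝ => 1/4 * u * ((1-u^2) * √(1-u^2)) + 3/8 * u * √(1-u^2) + 3/8 * Real.arcsin u)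
    (f' := fun u : ℝ => (1-u^2) * √(1-u^2)) zero_le_one ?_ ?_ ?_
  · have e : ∫ u in (0:ℝ)..1, (1-u^2) ^ ((3:ℝ)/2) = ∫ u in (0:ℝ)..1, (1-u^2) * √(1-u^2) := by
      apply intervalIntegral.integral_congr
      intro u hu
      rw [Set.uIcc_of_le zero_le_one] at hu
      simp only
      have h : 0 ≤ 1 - u^2 := by nlinarith [hu.1, hu.2]
      rw [show (3:ℝ)/2 = 1 + 1/2 by norm_num, Real.rpow_add_of_nonneg h (by norm_num) (by norm_num), Real.rpow_one, Real.sqrt_eq_rpow]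
    rw [e, this]
    simp
    ring
  · apply Continuous.continuousOn
    have := Real.continuous_arcsin
    fun_prop
  · intro u hu
    have h : 0 < 1 - u^2 := by nlinarith [hu.1, hu.2]
    have hs : 0 < √(1-u^2) := Real.sqrt_pos.2 h
    have hs2 := Real.sq_sqrt h.le
    have d0 : HasDerivAt (fun u : ℝ => 1 - u^2) (-(2*u)) u := by
      simpa using (hasDerivAt_pow 2 u).const_sub 1
    have d1 := d0.sqrt h.ne'
    have d2 := Real.hasDerivAt_arcsin (x := u) (by linarith [hu.1]) (by linarith [hu.2])
    have d3 := ((((hasDerivAt_id u).const_mul (1/4)).mul (d0.mul d1)).add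
      (((hasDerivAt_id u).const_mul (3/8)).mul d1)).add (d2.const_mul (3/8))
    refine (d3.congr_deriv ?_)
    simp only [id, Pi.mul_apply]
    set s := √(1-u^2)
    have hu2 : u^2 = 1 - s^2 := by linarith
    have hu4 : u^4 = (1 - s^2)^2 := by rw [← hu2]; ring
    field_simp
    ring_nf
    rw [hu4, hu2]
    ring
  · apply Continuous.intervalIntegrable
    fun_prop


open FourierTransform in
lemma poly_fourier_bigO (a : ℝ) : (𝓕 (fun y : ℝ => ((max (a - y^2) 0 : ℝ) : ℂ))) =O[Filter.cocompact ℝ]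
    (fun x : ℝ => |x| ^ (-2:ℝ)) := by
  rcases le_or_gt a 0 with ha | ha
  · have : (fun y : ℝ => ((max (a - y^2) 0 : ℝ) : ℂ)) = fun _ => 0 := by
      ext y
      rw [max_eq_right (by nlinarith)]; simp
    rw [this]
    have h2 : (𝓕 (fun _ : ℝ => (0:ℂ))) = fun _ => 0 := by
      ext w
      rw [Real.fourier_real_eq_integral_exp_smul]; simp
    rw [h2]
    exact Asymptotics.isBigO_zero _ _
  · set s := √a with hs
    have hs0 : 0 ≤ s := Real.sqrt_nonneg a
    have hs2 : s^2 = a := Real.sq_sqrt ha.le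
    refine Asymptotics.IsBigO.of_bound (4*s+4) ?_
    have hev : ∀ᶠ x : ℝ in Filter.cocompact ℝ, 1 ≤ ‖x‖ := tendsto_norm_cocompact_atTop.eventually_ge_atTop 1
    filter_upwards [hev] with w hw
    rw [Real.norm_eq_abs] at hw
    rw [Real.fourier_real_eq_integral_exp_smul]
    set c : ℂ := -2 * π * w * Complex.I with hc
    have hcn : ‖c‖ = 2 * π * |w| := by
      rw [hc]; simp [abs_of_pos Real.pi_pos]
    have hcw : |w| ≤ ‖c‖ := by
      rw [hcn]; nlinarith [Real.pi_gt_three]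
    have hc1 : 1 ≤ ‖c‖ := hw.trans hcw
    have hc0 : c ≠ 0 := by
      intro h; rw [h] at hc1; norm_num at hc1
    have e1 : ∫ v : ℝ, Complex.exp (((-2 * π * v * w : ℝ) : ℂ) * Complex.I) • ((max (a - v^2) 0 : ℝ) : ℂ)
        = ∫ v in (-s)..s, ((a:ℂ) - v^2) * Complex.exp (c * v) := by
      rw [integral_eq_interval (a := -s) (b := s)]
      · apply intervalIntegral.integral_congr
        intro y hy
        rw [Set.uIcc_of_le (by linarith)] at hy
        simp only
        rw [max_eq_left (by nlinarith [abs_le.2 hy, sq_abs y, abs_nonneg y]), smul_eq_mul, mul_comm]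
        push_cast
        congr 2
        rw [hc]; ring
      · intro y hy
        simp only [Set.mem_Ioo, not_and_or, not_lt] at hy
        rw [max_eq_right]; · simp
        rcases hy with h | h <;> nlinarith
    rw [e1]
    have e2 := intervalIntegral.integral_eq_sub_of_hasDerivAt (a := -s) (b := s)
      (f := fun v : ℝ => (((a:ℂ) - v^2)/c + 2*v/c^2 - 2/c^3) * Complex.exp (c * v))
      (f' := fun v : ℝ => ((a:ℂ) - v^2) * Complex.exp (c * v)) ?_ ?_
    · rw [e2]
      have hb : ∀ v : ℝ, |v| = s → ‖(((a:ℂ) - v^2)/c + 2*v/c^2 - 2/c^3) * Complex.exp (c * v)‖ ≤ (2*s+2) * |w|^(-2:ℝ) := by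
        intro v hv
        have hav : (a:ℂ) - v^2 = 0 := by
          have : a - v^2 = 0 := by rw [← sq_abs, hv, hs2]; ring
          exact_mod_cast this
        have hexp : ‖Complex.exp (c * v)‖ = 1 := by
          rw [Complex.norm_exp]; simp [hc]
        rw [hav, zero_div, zero_add, norm_mul, hexp, mul_one]
        have h1 : ‖(2*v/c^2 : ℂ)‖ = 2 * s / ‖c‖^2 := by simp [hv]
        have h2 : ‖(2/c^3 : ℂ)‖ = 2 / ‖c‖^3 := by simp
        have h3 : 2 / ‖c‖^3 ≤ 2/‖c‖^2 := by
          gcongr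
          norm_num
        calc _ ≤ 2 * s / ‖c‖^2 + 2 / ‖c‖^3 := by rw [← h1, ← h2]; exact norm_sub_le _ _
          _ ≤ 2 * s / ‖c‖^2 + 2 / ‖c‖^2 := by linarith
          _ = (2*s+2)/‖c‖^2 := by ring
          _ ≤ (2*s+2)/|w|^2 := by gcongr
          _ = _ := by rw [Real.rpow_neg (abs_nonneg _)]; norm_cast
      have b1 := hb s (abs_of_nonneg hs0)
      have b2 := hb (-s) (by rw [abs_neg, abs_of_nonneg hs0])
      refine (norm_sub_le _ _).trans ?_
      rw [Real.norm_of_nonneg (by positivity)]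
      refine (add_le_add b1 b2).trans (le_of_eq (by ring))
    · intro v _
      have d1 : HasDerivAt (fun v : ℂ => (((a:ℂ) - v^2)/c + 2*v/c^2 - 2/c^3) * Complex.exp (c * v)) 
          (((a:ℂ) - v^2) * Complex.exp (c * v)) (v:ℂ) := by
        have q1 : HasDerivAt (fun v : ℂ => (((a:ℂ) - v^2)/c + 2*v/c^2 - 2/c^3)) (-(2*v)/c + 2/c^2) (v:ℂ) := by
          have a1 := ((hasDerivAt_pow 2 (v:ℂ)).const_sub (a:ℂ)).div_const c
          have a2 := ((hasDerivAt_id (v:ℂ)).const_mul 2).div_const (c^2)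
          have := (a1.add a2).sub_const (2/c^3)
          simpa using this
        have q2 : HasDerivAt (fun v : ℂ => Complex.exp (c * v)) (Complex.exp (c * v) * c) (v:ℂ) := by
          simpa using ((hasDerivAt_id (v:ℂ)).const_mul c).cexp
        refine (q1.mul q2).congr_deriv ?_
        field_simp
        ring
      exact d1.comp_ofReal
    · apply Continuous.intervalIntegrable
      fun_prop

lemma bigO_of_compact {f : ℝ → ℂ} {M : ℝ} (h : ∀ x, M ≤ |x| → f x = 0) (b : ℝ) :
    f =O[Filter.cocompact ℝ] (fun x : ℝ => |x| ^ (-b)) := by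
  have hev : ∀ᶠ x : ℝ in Filter.cocompact ℝ, M ≤ ‖x‖ := tendsto_norm_cocompact_atTop.eventually_ge_atTop M
  refine Asymptotics.IsBigO.of_bound 1 ?_
  filter_upwards [hev] with x hx
  rw [h x hx, norm_zero]
  positivity

lemma ff_zero_of_abs {X x y : ℝ} (hX : 0 < X) (h : √X ≤ |x| ∨ √X ≤ |y|) : ff X x y = 0 := by
  apply ff_zero
  have hs2 := Real.sq_sqrt hX.le
  have hs := Real.sqrt_nonneg X
  rw [← sq_abs x, ← sq_abs y]
  rcases h with h | h <;> nlinarith [sq_nonneg |x|, sq_nonneg |y|]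

open FourierTransform in
noncomputable def GG (X l x : ℝ) : ℂ := 𝓕 (fun y : ℝ => (ff X x y : ℂ)) l

open FourierTransform in
lemma poisson_inner {X : ℝ} (hX : 0 < X) (x : ℝ) :
    (Summable fun l : ℤ => GG X l x) ∧ ∑' m : ℤ, (ff X x m : ℂ) = ∑' l : ℤ, GG X l x := by
  have hO := poly_fourier_bigO (X - x^2)
  constructor
  · exact summable_of_isBigO (Real.summable_abs_int_rpow one_lt_two) (hO.comp_tendsto Int.tendsto_coe_cofinite)
  · have := Real.tsum_eq_tsum_fourier_of_rpow_decay (f := fun y : ℝ => (ff X x y : ℂ)) (b := 2) 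
      (by unfold ff; fun_prop) one_lt_two
      (bigO_of_compact (M := √X) (fun y hy => by rw [ff_zero_of_abs hX (Or.inr hy)]; simp) 2) hO 0
    simpa [GG] using this

lemma GG_eq (X l x : ℝ) : GG X l x = ∫ y : ℝ, Complex.exp (((-2 * π * y * l : ℝ) : ℂ) * Complex.I) * (ff X x y : ℂ) := by
  unfold GG
  rw [Real.fourier_real_eq_integral_exp_smul]
  rfl

lemma GG_zero {X : ℝ} (hX : 0 < X) (l : ℝ) {x : ℝ} (hx : √X ≤ |x|) : GG X l x = 0 := by
  rw [GG_eq]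
  simp [ff_zero_of_abs hX (Or.inl hx)]

lemma GG_cont {X : ℝ} (hX : 0 < X) (l : ℝ) : Continuous (GG X l) := by
  have : GG X l = fun x => ∫ y in Set.Icc (-√X) (√X), Complex.exp (((-2 * π * y * l : ℝ) : ℂ) * Complex.I) * (ff X x y : ℂ) := by
    ext x
    rw [GG_eq, setIntegral_eq_integral_of_forall_compl_eq_zero]
    intro y hy
    rw [Set.mem_Icc, ← abs_le, not_le] at hy
    rw [ff_zero_of_abs hX (Or.inr hy.le)]; simp
  rw [this]
  apply continuous_parametric_integral_of_continuous _ isCompact_Icc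
  unfold ff Function.uncurry
  fun_prop

open FourierTransform in
lemma GG_fourier {X : ℝ} (hX : 0 < X) (k l : ℝ) : 𝓕 (GG X l) k = ((8/3 * X^2 * Ih (2 * π * √X * √(k^2+l^2)) : ℝ) : ℂ) := by
  rw [← KK_val hX, Real.fourier_real_eq_integral_exp_smul, Measure.volume_eq_prod, 
    integral_prod _ (by rw [← Measure.volume_eq_prod]; exact KK_int X k l)]
  congr 1
  ext x
  rw [GG_eq, smul_eq_mul, ← integral_const_mul]
  congr 1
  ext y
  unfold KK
  rw [← mul_assoc, ← Complex.exp_add]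
  congr 2
  push_cast; ring

lemma Ih_bound : ∃ C : ℝ, 0 ≤ C ∧ ∀ z : ℝ, 1 ≤ z → |Ih z| ≤ C * z ^ (-(5/2):ℝ) := by
  refine ⟨3/2 * √2 * √π + 45/16 * √2 * √π + Real.Gamma (9/2), ?_, ?_⟩
  · have := Real.Gamma_pos_of_pos (s := 9/2) (by norm_num)
    positivity
  intro z hz
  have h := Ih_asymp hz
  have hG := Real.Gamma_pos_of_pos (s := 9/2) (by norm_num)
  have h1 : z ^ (-(7/2):ℝ) ≤ z ^ (-(5/2):ℝ) := Real.rpow_le_rpow_of_exponent_le hz (by norm_num)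
  have h2 : z ^ (-(9/2):ℝ) ≤ z ^ (-(5/2):ℝ) := Real.rpow_le_rpow_of_exponent_le hz (by norm_num)
  have p5 : 0 ≤ z ^ (-(5/2):ℝ) := by positivity
  have p7 : 0 ≤ z ^ (-(7/2):ℝ) := by positivity
  have p9 : 0 ≤ z ^ (-(9/2):ℝ) := by positivity
  have b1 : |(-(3/2 * √2 * √π) * Real.cos (z - π/4) * z ^ (-(5/2):ℝ))| ≤ 3/2 * √2 * √π * z ^ (-(5/2):ℝ) := by
    rw [abs_mul, abs_mul, abs_neg, abs_of_nonneg p5, abs_of_nonneg (a := 3/2 * √2 * √π) (by positivity)]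
    have := Real.abs_cos_le_one (z - π/4)
    exact mul_le_mul_of_nonneg_right (mul_le_of_le_one_right (by positivity) this) p5
  have b2 : |(45/16 * √2 * √π) * Real.sin (z - π/4) * z ^ (-(7/2):ℝ)| ≤ 45/16 * √2 * √π * z ^ (-(5/2):ℝ) := by
    rw [abs_mul, abs_mul, abs_of_nonneg p7, abs_of_nonneg (a := 45/16 * √2 * √π) (by positivity)]
    have := Real.abs_sin_le_one (z - π/4)
    exact mul_le_mul (mul_le_of_le_one_right (by positivity) this) h1 p7 (by positivity)
  have b3 : Real.Gamma (9/2) * z ^ (-(9/2):ℝ) ≤ Real.Gamma (9/2) * z ^ (-(5/2):ℝ) := by gcongr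
  rw [abs_le] at *
  constructor <;> linarith [h.1, h.2, b1.1, b1.2, b2.1, b2.2]


lemma znorm_pos {p : ℤ × ℤ} (hp : p ≠ 0) : 1 ≤ znorm p := by
  unfold znorm
  rw [Real.one_le_sqrt]
  have : 0 < p.1^2 + p.2^2 := by
    by_contra h
    push Not at h
    apply hp
    ext
    · simp; nlinarith [sq_nonneg p.1, sq_nonneg p.2]
    · simp; nlinarith [sq_nonneg p.1, sq_nonneg p.2]
  exact_mod_cast this

lemma znorm_nonneg (p : ℤ × ℤ) : 0 ≤ znorm p := Real.sqrt_nonneg _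

lemma znorm_summable {k : ℝ} (hk : 2 < k) : Summable fun p : ℤ × ℤ => znorm p ^ (-k) := by
  have h := (finTwoArrowEquiv ℤ).symm.summable_iff.2 (EisensteinSeries.summable_one_div_norm_rpow hk)
  refine Summable.of_nonneg_of_le (fun p => Real.rpow_nonneg (znorm_nonneg p) _) (fun p => ?_) h
  by_cases hp : p = 0
  · subst hp
    have e1 : znorm 0 = 0 := by simp [znorm]
    rw [e1, Real.zero_rpow (by linarith)]
    simp only [Function.comp]
    positivity
  · simp only [Function.comp]
    apply Real.rpow_le_rpow_of_nonpos
    · rw [norm_pos_iff]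
      intro h0
      apply hp
      have := (finTwoArrowEquiv ℤ).symm.injective (a₁ := p) (a₂ := 0) (by rw [h0]; ext i; fin_cases i <;> rfl)
      exact this
    · rw [pi_norm_le_iff_of_nonneg (znorm_nonneg p)]
      intro i
      unfold znorm
      apply Real.le_sqrt_of_sq_le
      fin_cases i <;> simp [finTwoArrowEquiv, Int.norm_eq_abs] <;> positivity
    · linarith

lemma box_abs {X : ℝ} {n : ℤ} (h : n ∉ Finset.Icc (-⌈√X⌉) ⌈√X⌉) : √X ≤ |(n:ℝ)| := by
  rw [Finset.mem_Icc, ← abs_le, not_le] at h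
  refine (Int.le_ceil (√X)).trans ?_
  exact_mod_cast h.le

noncomputable def RR (X : ℝ) (p : ℤ × ℤ) : ℝ := 8/3 * X^2 * Ih (2 * π * √X * znorm p)

lemma RR_summable {X : ℝ} (hX1 : 1 ≤ 2 * π * √X) : Summable (RR X) := by
  obtain ⟨C, hC, hb⟩ := Ih_bound
  have hs := (znorm_summable (k := 5/2) (by norm_num)).mul_left (8/3 * X^2 * C)
  refine Summable.of_norm_bounded_eventually hs ?_
  have : ∀ᶠ p : ℤ × ℤ in Filter.cofinite, p ≠ 0 := by
    simp [Filter.eventually_cofinite]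
  filter_upwards [this] with p hp
  have h1 := znorm_pos hp
  have h2 : znorm p ≤ 2 * π * √X * znorm p := le_mul_of_one_le_left (by linarith) hX1
  unfold RR
  rw [norm_mul, Real.norm_of_nonneg (by positivity), Real.norm_eq_abs, mul_assoc _ C]
  refine mul_le_mul_of_nonneg_left ?_ (by positivity)
  refine (hb _ (h1.trans h2)).trans (mul_le_mul_of_nonneg_left ?_ hC)
  exact Real.rpow_le_rpow_of_nonpos (by linarith) h2 (by norm_num)

open FourierTransform in
lemma poisson_outer {X : ℝ} (hX : 0 < X) (hX1 : 1 ≤ 2 * π * √X) (l : ℤ) :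
    ∑' n : ℤ, GG X l n = ∑' k : ℤ, ((RR X (l, k) : ℝ) : ℂ) := by
  have hO : (𝓕 (GG X l)) =O[Filter.cocompact ℝ] (fun x : ℝ => |x| ^ (-(5/2):ℝ)) := by
    obtain ⟨C, hC, hb⟩ := Ih_bound
    refine Asymptotics.IsBigO.of_bound (8/3 * X^2 * C) ?_
    have hev : ∀ᶠ x : ℝ in Filter.cocompact ℝ, 1 ≤ ‖x‖ := tendsto_norm_cocompact_atTop.eventually_ge_atTop 1
    filter_upwards [hev] with k hk
    rw [Real.norm_eq_abs] at hk
    have h0 : |k| ≤ √(k^2 + (l:ℝ)^2) := Real.abs_le_sqrt (by nlinarith [sq_nonneg (l:ℝ)])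
    have h2 : |k| ≤ 2 * π * √X * √(k^2 + (l:ℝ)^2) := h0.trans (le_mul_of_one_le_left (Real.sqrt_nonneg _) hX1)
    rw [GG_fourier hX, Complex.norm_real, norm_mul, Real.norm_of_nonneg (by positivity), Real.norm_eq_abs, mul_assoc _ C,
      Real.norm_of_nonneg (by positivity)]
    refine mul_le_mul_of_nonneg_left ?_ (by positivity)
    refine (hb _ (hk.trans h2)).trans (mul_le_mul_of_nonneg_left ?_ hC)
    exact Real.rpow_le_rpow_of_nonpos (by linarith) h2 (by norm_num)
  have := Real.tsum_eq_tsum_fourier_of_rpow_decay (f := GG X l) (b := 5/2) (GG_cont hX l) (by norm_num)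
      (bigO_of_compact (M := √X) (fun x hx => GG_zero hX l hx) (5/2)) hO 0
  simp only [zero_add] at this
  rw [this]
  congr 1
  ext k
  rw [GG_fourier hX]
  simp only [RR, znorm]
  rw [add_comm ((k:ℝ)^2)]
  simp

lemma ff_summable {X : ℝ} (hX : 0 < X) : Summable fun p : ℤ × ℤ => ff X p.1 p.2 := by
  apply summable_of_ne_finset_zero (s := Finset.Icc (-⌈√X⌉) ⌈√X⌉ ×ˢ Finset.Icc (-⌈√X⌉) ⌈√X⌉)
  intro p hp
  rw [Finset.mem_product, not_and_or] at hp
  apply ff_zero_of_abs hX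
  rcases hp with h | h
  · exact Or.inl (box_abs h)
  · exact Or.inr (box_abs h)

lemma poisson2 {X : ℝ} (hX : 0 < X) (hX1 : 1 ≤ 2 * π * √X) :
    ∑' p : ℤ × ℤ, ff X p.1 p.2 = ∑' p, RR X p := by
  have hS : Summable fun p : ℤ × ℤ => (ff X p.1 p.2 : ℂ) := by
    exact_mod_cast ff_summable hX
  have hR : Summable fun p : ℤ × ℤ => (RR X p : ℂ) := by
    exact_mod_cast RR_summable hX1
  apply Complex.ofReal_injective
  rw [Complex.ofReal_tsum, Complex.ofReal_tsum, hS.tsum_prod, hR.tsum_prod]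
  simp only
  calc ∑' n : ℤ, ∑' m : ℤ, (ff X n m : ℂ) = ∑' n : ℤ, ∑' l : ℤ, GG X l n := by
        congr 1; ext n; exact (poisson_inner hX n).2
    _ = ∑ n ∈ Finset.Icc (-⌈√X⌉) ⌈√X⌉, ∑' l : ℤ, GG X l n := by
        apply tsum_eq_sum
        intro n hn
        simp [GG_zero hX _ (box_abs hn)]
    _ = ∑' l : ℤ, ∑ n ∈ Finset.Icc (-⌈√X⌉) ⌈√X⌉, GG X l n := by
        rw [Summable.tsum_finsetSum]
        intro n _
        exact (poisson_inner hX n).1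
    _ = ∑' l : ℤ, ∑' n : ℤ, GG X l n := by
        congr 1; ext l
        symm
        apply tsum_eq_sum
        intro n hn
        exact GG_zero hX _ (box_abs hn)
    _ = _ := by
        congr 1; ext l
        exact poisson_outer hX hX1 l

lemma step_integral {c R : ℝ} (hc : 0 ≤ c) (hR : 0 ≤ R) :
    IntervalIntegrable (fun t => if c ≤ t then (1:ℝ) else 0) volume 0 R ∧
    ∫ t in (0:ℝ)..R, (if c ≤ t then (1:ℝ) else 0) = max (R - c) 0 := by
  have e : (fun t : ℝ => if c ≤ t then (1:ℝ) else 0) = (Set.Ici c).indicator (fun _ => 1) := by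
    ext t; simp [Set.indicator]
  rw [e]
  constructor
  · rw [intervalIntegrable_iff_integrableOn_Ioc_of_le hR]
    exact (integrable_const _).indicator measurableSet_Ici
  · rw [intervalIntegral.integral_of_le hR, setIntegral_indicator measurableSet_Ici]
    rcases hc.eq_or_lt with h | h
    · subst h
      have : Set.Ioc 0 R ∩ Set.Ici 0 = Set.Ioc 0 R := by
        ext x; simp; intro h _; exact h.le
      rw [this]; simp [hR]
    · have : Set.Ioc 0 R ∩ Set.Ici c = Set.Icc c R := by
        ext x; simp only [Set.mem_inter_iff, Set.mem_Ioc, Set.mem_Ici, Set.mem_Icc]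
        constructor
        · rintro ⟨⟨_, h2⟩, h3⟩; exact ⟨h3, h2⟩
        · rintro ⟨h1, h2⟩; exact ⟨⟨by linarith, h2⟩, h1⟩
      rw [this]; simp

lemma D_integral {R : ℝ} (hR : 1 ≤ R) :
    ∫ t in (0:ℝ)..R, Dlat t = 4 * π^2 * (∑' p : ℤ × ℤ, ff (R / (4 * π^2)) p.1 p.2) - R^2/(8*π) := by
  set X := R / (4 * π^2) with hXd
  have hpi := Real.pi_pos
  have hX : 0 < X := by positivity
  have hRX : R = 4 * π^2 * X := by rw [hXd]; field_simp
  let S := Finset.Icc (-⌈√X⌉) ⌈√X⌉ ×ˢ Finset.Icc (-⌈√X⌉) ⌈√X⌉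
  let c : ℤ × ℤ → ℝ := fun p => 4 * π^2 * ((p.1:ℝ)^2 + (p.2:ℝ)^2)
  have hc : ∀ p, 0 ≤ c p := fun p => by positivity
  have hcond : ∀ (p : ℤ × ℤ) (t : ℝ), 0 ≤ t → (znorm p ≤ √t / (2*π) ↔ c p ≤ t) := by
    intro p t ht
    unfold znorm
    rw [le_div_iff₀ (by positivity), Real.le_sqrt (by positivity) ht, mul_pow, Real.sq_sqrt (by positivity)]
    have : ((p.1:ℝ)^2 + (p.2:ℝ)^2) * (2*π)^2 = c p := by simp only [c]; ring
    rw [this]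
  have hN : ∀ t ∈ Set.uIcc 0 R, Dlat t = (∑ p ∈ S, if c p ≤ t then (1:ℝ) else 0) - t / (4*π) := by
    intro t ht
    rw [Set.uIcc_of_le (by linarith)] at ht
    unfold Dlat Nlat
    congr 1
    have : {n : ℤ × ℤ | znorm n ≤ √t / (2*π)} = ((S.filter fun p => c p ≤ t : Finset (ℤ × ℤ)) : Set (ℤ × ℤ)) := by
      ext p
      simp only [Set.mem_ofPred_eq, Finset.coe_filter]
      rw [hcond p t ht.1]
      refine ⟨fun h => ⟨?_, h⟩, fun h => h.2⟩
      have hq : (p.1:ℝ)^2 + (p.2:ℝ)^2 ≤ X := by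
        have h3 : c p ≤ R := h.trans ht.2
        rw [hRX] at h3
        exact le_of_mul_le_mul_left h3 (by positivity)
      have key : ∀ n : ℤ, (n:ℝ)^2 ≤ X → n ∈ Finset.Icc (-⌈√X⌉) ⌈√X⌉ := by
        intro n hn
        rw [Finset.mem_Icc, ← abs_le]
        have h4 := (Real.abs_le_sqrt hn).trans (Int.le_ceil (√X))
        exact_mod_cast h4
      exact Finset.mem_product.2 ⟨key _ (by nlinarith [sq_nonneg (p.2:ℝ)]), key _ (by nlinarith [sq_nonneg (p.1:ℝ)])⟩
    rw [this, Set.ncard_coe_finset, Finset.card_filter]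
    push_cast
    rfl
  rw [intervalIntegral.integral_congr hN, intervalIntegral.integral_sub, intervalIntegral.integral_finsetSum]
  · congr 1
    · have : ∑' p : ℤ × ℤ, ff X p.1 p.2 = ∑ p ∈ S, ff X p.1 p.2 := by
        apply tsum_eq_sum
        intro p hp
        rw [Finset.mem_product, not_and_or] at hp
        apply ff_zero_of_abs hX
        rcases hp with h | h
        · exact Or.inl (box_abs h)
        · exact Or.inr (box_abs h)
      rw [this, Finset.mul_sum]
      apply Finset.sum_congr rfl
      intro p _
      rw [(step_integral (hc p) (by linarith)).2]
      unfold ff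
      rw [mul_max_of_nonneg _ _ (by positivity), mul_zero, hRX]
      simp only [c]
      congr 1; ring
    · rw [intervalIntegral.integral_div]
      simp
      field_simp; norm_num
  · intro p _
    exact (step_integral (hc p) (by linarith)).1
  · have h5 := IntervalIntegrable.sum (μ := volume) (a := 0) (b := R) S (f := fun p t => if c p ≤ t then (1:ℝ) else 0)
      (fun p _ => (step_integral (hc p) (by linarith)).1)
    have h6 : (fun t => ∑ p ∈ S, if c p ≤ t then (1:ℝ) else 0) = ∑ p ∈ S, fun t => if c p ≤ t then (1:ℝ) else 0 := by
      funext t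
      simp [Finset.sum_apply]
    rw [h6]
    exact h5
  · apply Continuous.intervalIntegrable
    fun_prop

lemma A_formula {R : ℝ} (hR : 1 ≤ R) :
    (Summable fun n : {n : ℤ × ℤ // n ≠ 0} => 2 * R / (3 * π^2) * Ih (znorm n.1 * √R)) ∧
    Alat R = ∑' n : {n : ℤ × ℤ // n ≠ 0}, 2 * R / (3 * π^2) * Ih (znorm n.1 * √R) := by
  set X := R / (4 * π^2) with hXd
  have hpi := Real.pi_pos
  have hR0 : 0 < R := by linarith
  have hX : 0 < X := by positivity
  have hRX : R = 4 * π^2 * X := by rw [hXd]; field_simp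
  have hsq : 2 * π * √X = √R := by
    rw [hRX, show 4 * π^2 * X = (2*π)^2 * X by ring, Real.sqrt_mul (by positivity), Real.sqrt_sq (by positivity)]
  have hX1 : 1 ≤ 2 * π * √X := by rw [hsq]; exact Real.one_le_sqrt.2 hR
  have hs := RR_summable hX1
  have hterm : ∀ p, 4 * π^2 / R * RR X p = 2 * R / (3 * π^2) * Ih (znorm p * √R) := by
    intro p
    unfold RR
    rw [hsq, mul_comm (√R), hXd]
    field_simp
    ring
  have hsub : Summable fun n : {n : ℤ × ℤ // n ≠ 0} => RR X n.1 := hs.subtype _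
  have hsplit := hs.tsum_subtype_add_tsum_subtype_compl ({0} : Set (ℤ × ℤ))
  have h0 : ∑' x : ({0} : Set (ℤ × ℤ)), RR X x = RR X 0 := tsum_singleton 0 (RR X)
  have h1 : ∑' x : (({0} : Set (ℤ × ℤ))ᶜ : Set (ℤ × ℤ)), RR X x = ∑' n : {n : ℤ × ℤ // n ≠ 0}, RR X n.1 := rfl
  rw [h0, h1] at hsplit
  constructor
  · exact (hsub.mul_left (4 * π^2 / R)).congr (fun n => hterm n.1)
  · simp_rw [← hterm]
    rw [tsum_mul_left]
    unfold Alat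
    rw [D_integral hR, ← hXd, poisson2 hX hX1, ← hsplit]
    have : RR X 0 = π * X^2 / 2 := by
      have e1 : znorm 0 = 0 := by simp [znorm]
      unfold RR
      rw [e1, mul_zero, Ih_zero]; ring
    rw [this, hXd]
    field_simp
    ring

lemma pi_rpow : π ^ ((3:ℝ)/2) = π * √π := by
  rw [show (3:ℝ)/2 = 1 + 1/2 by norm_num, Real.rpow_add Real.pi_pos, Real.rpow_one, Real.sqrt_eq_rpow]


/-- Second-order asymptotics:
`A(R) = g₁(√R)·R^{-1/4} + g₂(√R)·R^{-3/4} + O(R^{-5/4})`. -/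
theorem average_asymptotics_second_order :
    ∃ C : ℝ, 0 < C ∧ ∀ R : ℝ, 1 ≤ R →
      |Alat R - g1 (Real.sqrt R) * R ^ (-(1/4) : ℝ) - g2 (Real.sqrt R) * R ^ (-(3/4) : ℝ)|
        ≤ C * R ^ (-(5/4) : ℝ) := by
  have hpi := Real.pi_pos
  have hG := Real.Gamma_pos_of_pos (s := 9/2) (by norm_num)
  have hz9 : Summable fun n : {n : ℤ × ℤ // n ≠ 0} => znorm n.1 ^ (-(9/2):ℝ) :=
    (znorm_summable (k := 9/2) (by norm_num)).subtype _
  have hz5 : Summable fun n : {n : ℤ × ℤ // n ≠ 0} => znorm n.1 ^ (-(5/2):ℝ) :=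
    (znorm_summable (k := 5/2) (by norm_num)).subtype _
  have hz7 : Summable fun n : {n : ℤ × ℤ // n ≠ 0} => znorm n.1 ^ (-(7/2):ℝ) :=
    (znorm_summable (k := 7/2) (by norm_num)).subtype _
  have hT : 0 ≤ ∑' n : {n : ℤ × ℤ // n ≠ 0}, znorm n.1 ^ (-(9/2):ℝ) :=
    tsum_nonneg fun n => Real.rpow_nonneg (znorm_nonneg _) _
  refine ⟨2 / (3 * π^2) * Real.Gamma (9/2) * (∑' n : {n : ℤ × ℤ // n ≠ 0}, znorm n.1 ^ (-(9/2):ℝ)) + 1,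
    by positivity, ?_⟩
  intro R hR
  have hR0 : 0 < R := by linarith
  obtain ⟨hs, hA⟩ := A_formula hR
  have hc5 : Summable fun n : {n : ℤ × ℤ // n ≠ 0} => znorm n.1 ^ (-(5/2):ℝ) * Real.cos (znorm n.1 * √R - π/4) := by
    refine Summable.of_norm_bounded hz5 fun n => ?_
    rw [norm_mul, Real.norm_of_nonneg (Real.rpow_nonneg (znorm_nonneg _) _)]
    exact mul_le_of_le_one_right (Real.rpow_nonneg (znorm_nonneg _) _) (Real.abs_cos_le_one _)
  have hs7 : Summable fun n : {n : ℤ × ℤ // n ≠ 0} => znorm n.1 ^ (-(7/2):ℝ) * Real.sin (znorm n.1 * √R - π/4) := by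
    refine Summable.of_norm_bounded hz7 fun n => ?_
    rw [norm_mul, Real.norm_of_nonneg (Real.rpow_nonneg (znorm_nonneg _) _)]
    exact mul_le_of_le_one_right (Real.rpow_nonneg (znorm_nonneg _) _) (Real.abs_sin_le_one _)
  rw [hA]
  unfold g1 g2
  rw [mul_right_comm, mul_right_comm (15 * √2 / (8 * π ^ ((3:ℝ)/2))), ← tsum_mul_left, ← tsum_mul_left,
    ← hs.tsum_sub (hc5.mul_left _), ← (hs.sub (hc5.mul_left _)).tsum_sub (hs7.mul_left _)]
  have hbound : ∀ n : {n : ℤ × ℤ // n ≠ 0}, ‖2 * R / (3 * π^2) * Ih (znorm n.1 * √R) -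
      -(√2 / π ^ ((3:ℝ)/2)) * R ^ (-(1/4):ℝ) * (znorm n.1 ^ (-(5/2):ℝ) * Real.cos (znorm n.1 * √R - π/4)) -
      15 * √2 / (8 * π ^ ((3:ℝ)/2)) * R ^ (-(3/4):ℝ) * (znorm n.1 ^ (-(7/2):ℝ) * Real.sin (znorm n.1 * √R - π/4))‖
      ≤ 2 / (3 * π^2) * Real.Gamma (9/2) * R ^ (-(5/4):ℝ) * znorm n.1 ^ (-(9/2):ℝ) := by
    intro n
    have hn := znorm_pos n.2
    have hn0 := znorm_nonneg n.1
    set v := znorm n.1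
    have hsR : 1 ≤ √R := Real.one_le_sqrt.2 hR
    have hz : 1 ≤ v * √R := by nlinarith
    have h := Ih_asymp hz
    have hpw : ∀ s : ℝ, (v * √R) ^ s = v ^ s * R ^ (s/2) := by
      intro s
      rw [Real.mul_rpow hn0 (Real.sqrt_nonneg _), Real.sqrt_eq_rpow, ← Real.rpow_mul hR0.le]
      congr 2; ring
    have hRp : ∀ s : ℝ, R * R ^ s = R ^ (1 + s) := by
      intro s; rw [Real.rpow_add hR0, Real.rpow_one]
    have q1 : R ^ (-(1/4):ℝ) = R * R ^ (-(5/2)/2:ℝ) := by rw [hRp]; norm_num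
    have q2 : R ^ (-(3/4):ℝ) = R * R ^ (-(7/2)/2:ℝ) := by rw [hRp]; norm_num
    have q3 : R ^ (-(5/4):ℝ) = R * R ^ (-(9/2)/2:ℝ) := by rw [hRp]; norm_num
    rw [hpw, hpw, hpw] at h
    rw [q1, q2, q3, pi_rpow, Real.norm_eq_abs]
    have hsp : 0 < √π := Real.sqrt_pos.2 hpi
    have hsp2 : √π ^ 2 = π := Real.sq_sqrt hpi.le
    have r1 : √2 / (π * √π) = √2 * √π / π^2 := by
      rw [div_eq_div_iff (by positivity) (by positivity)]
      linear_combination (-√2 * π) * hsp2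
    have r2 : 15 * √2 / (8 * (π * √π)) = 15/8 * (√2 * √π / π^2) := by
      rw [← r1]; field_simp
    rw [r1, r2]
    have hk : 0 ≤ 2 * R / (3 * π^2) := by positivity
    have h2 := mul_le_mul_of_nonneg_left h hk
    rw [← abs_of_nonneg hk, ← abs_mul, abs_of_nonneg hk] at h2
    refine le_trans (le_of_eq ?_) (h2.trans (le_of_eq ?_))
    · congr 1
      field_simp
      ring
    · field_simp
  refine (tsum_of_norm_bounded (hz9.mul_left _).hasSum hbound).trans ?_
  rw [tsum_mul_left]
  have : 0 ≤ R ^ (-(5/4):ℝ) := by positivity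
  nlinarith
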